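/- arXiv:1102.1570 — 2 statements merged into one kernel-verified Lean document; each statement's English description precedes it below -/
import Mathlib

section
/- Let π: M → N be a contact-complex Riemannian submersion and let B be the associated (1,2)-tensor. Then the restriction of B to the horizontal distribution H is φ-invariant: B(φX, φY) = B(X, Y) for all horizontal vector fields X, Y. -/
/-!
Algebraic (Koszul-style) model of the geometry of a smooth Riemannian manifold:
`C` plays the role of the ring of smooth functions, `V` the `C`-module of smooth
vector fields, `act` the action of vector fields on functions as derivations,
`g` the Riemannian metric, `bracket` the Lie bracket and `nabla` the
Levi-Civita connection (characterized by being metric and torsion-free).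
-/
structure RiemData (C V : Type) [CommRing C] [Algebra ℝ C]
    [AddCommGroup V] [Module C V] where
  act : V → C → C
  g : V → V → C
  bracket : V → V → V
  nabla : V → V → V
  act_add_left : ∀ X Y f, act (X + Y) f = act X f + act Y f
  act_smul_left : ∀ (f : C) (X : V) (k : C), act (f • X) k = f * act X k
  act_add_right : ∀ X f k, act X (f + k) = act X f + act X k
  act_mul_right : ∀ X f k, act X (f * k) = f * act X k + k * act X f
  act_const : ∀ X (r : ℝ), act X ((algebraMap ℝ C) r) = 0
  g_symm : ∀ X Y, g X Y = g Y X
  g_add_left : ∀ X Y Z, g (X + Y) Z = g X Z + g Y Z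
  g_smul_left : ∀ (f : C) X Y, g (f • X) Y = f * g X Y
  bracket_antisymm : ∀ X Y, bracket X Y = - bracket Y X
  bracket_act : ∀ X Y f, act (bracket X Y) f = act X (act Y f) - act Y (act X f)
  nabla_add_left : ∀ X Y Z, nabla (X + Y) Z = nabla X Z + nabla Y Z
  nabla_smul_left : ∀ (f : C) X Y, nabla (f • X) Y = f • nabla X Y
  nabla_add_right : ∀ X Y Z, nabla X (Y + Z) = nabla X Y + nabla X Z
  nabla_smul_right : ∀ (f : C) X Y, nabla X (f • Y) = act X f • Y + f • nabla X Y
  nabla_metric : ∀ X Y Z, act X (g Y Z) = g (nabla X Y) Z + g Y (nabla X Z)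
  nabla_torsion_free : ∀ X Y, nabla X Y - nabla Y X = bracket X Y

namespace RiemData

variable {C V : Type} [CommRing C] [Algebra ℝ C] [AddCommGroup V] [Module C V]
variable (D : RiemData C V)

/-- The curvature operator `R(X,Y)Z = ∇_X∇_Y Z - ∇_Y∇_X Z - ∇_{[X,Y]}Z`. -/
def R (X Y Z : V) : V :=
  D.nabla X (D.nabla Y Z) - D.nabla Y (D.nabla X Z) - D.nabla (D.bracket X Y) Z

/-- The `(0,4)` Riemann curvature tensor `R(X,Y,Z,W) = g(R(X,Y)Z, W)`. -/
def Rm (X Y Z W : V) : C := D.g (D.R X Y Z) W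

/-- Covariant derivative of a `2`-form (`(0,2)`-tensor). -/
def cov2 (ω : V → V → C) (X Y Z : V) : C :=
  D.act X (ω Y Z) - ω (D.nabla X Y) Z - ω Y (D.nabla X Z)

/-- Covariant derivative of a `3`-form (`(0,3)`-tensor). -/
def cov3 (ω : V → V → V → C) (X Y Z W : V) : C :=
  D.act X (ω Y Z W) - ω (D.nabla X Y) Z W - ω Y (D.nabla X Z) W - ω Y Z (D.nabla X W)

/-- A family of vector fields is an orthonormal frame. -/
def Orthonormal {ι : Type} [DecidableEq ι] (e : ι → V) : Prop :=
  ∀ i j, D.g (e i) (e j) = if i = j then (1 : C) else 0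

/-- The codifferential of a `2`-form evaluated on a vector field, computed as the
metric trace of the covariant derivative in the orthonormal frame `e`:
`(δω)(X) = -∑ᵢ (∇_{eᵢ} ω)(eᵢ, X)`. -/
def codiff2 {ι : Type} [Fintype ι] (e : ι → V) (ω : V → V → C) (X : V) : C :=
  -∑ i, D.cov2 ω (e i) (e i) X

/-- The codifferential of a `3`-form, `(δω)(Y,Z) = -∑ᵢ (∇_{eᵢ} ω)(eᵢ, Y, Z)`. -/
def codiff3 {ι : Type} [Fintype ι] (e : ι → V) (ω : V → V → V → C) (Y Z : V) : C :=
  -∑ i, D.cov3 ω (e i) (e i) Y Z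

/-- Exterior differential of a `1`-form. -/
def d1 (θ : V → C) (X Y : V) : C :=
  D.act X (θ Y) - D.act Y (θ X) - θ (D.bracket X Y)

/-- Exterior differential of a `2`-form. -/
def d2 (ω : V → V → C) (X Y Z : V) : C :=
  D.act X (ω Y Z) - D.act Y (ω X Z) + D.act Z (ω X Y)
    - ω (D.bracket X Y) Z + ω (D.bracket X Z) Y - ω (D.bracket Y Z) X

end RiemData

/-- An almost contact metric structure `(φ, ξ, η, g)` on top of the Riemannian data:
`φ² = -I + η ⊗ ξ`, `η(ξ) = 1`, `g(φX, φY) = g(X,Y) - η(X)η(Y)`, `η(X) = g(X,ξ)`. -/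
structure ACMData (C V : Type) [CommRing C] [Algebra ℝ C]
    [AddCommGroup V] [Module C V] extends RiemData C V where
  phi : V → V
  xi : V
  eta : V → C
  phi_add : ∀ X Y, phi (X + Y) = phi X + phi Y
  phi_smul : ∀ (f : C) X, phi (f • X) = f • phi X
  eta_eq : ∀ X, eta X = g X xi
  phi_phi : ∀ X, phi (phi X) = -X + eta X • xi
  eta_xi : eta xi = 1
  g_phi : ∀ X Y, g (phi X) (phi Y) = g X Y - eta X * eta Y

namespace ACMData

variable {C V : Type} [CommRing C] [Algebra ℝ C] [AddCommGroup V] [Module C V]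
variable (D : ACMData C V)

/-- The fundamental `2`-form `Φ(X,Y) = g(X, φY)`. -/
def Phi (X Y : V) : C := D.g X (D.phi Y)

/-- The tensor `A* X = -∇_X ξ` of Olszak. -/
def Astar (X : V) : V := -D.nabla X D.xi

/-- Gray-type curvature condition `K_{1φ}`: `R(X,Y,Z,W) = R(X,Y,φZ,φW)`. -/
def K1phi : Prop :=
  ∀ X Y Z W : V, D.toRiemData.Rm X Y Z W = D.toRiemData.Rm X Y (D.phi Z) (D.phi W)

/-- Gray-type curvature condition `K_{2φ}`. -/
def K2phi : Prop :=
  ∀ X Y Z W : V, D.toRiemData.Rm X Y Z W =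
    D.toRiemData.Rm (D.phi X) Y Z (D.phi W) + D.toRiemData.Rm X (D.phi Y) Z (D.phi W)
      + D.toRiemData.Rm X Y (D.phi Z) (D.phi W)

/-- Gray-type curvature condition `K_{3φ}`: `R(X,Y,Z,W) = R(φX,φY,φZ,φW)`. -/
def K3phi : Prop :=
  ∀ X Y Z W : V, D.toRiemData.Rm X Y Z W =
    D.toRiemData.Rm (D.phi X) (D.phi Y) (D.phi Z) (D.phi W)

/-- `M` is almost cosymplectic when `dΦ = 0` and `dη = 0`. -/
def AlmostCosymplectic : Prop :=
  (∀ X Y Z : V, D.toRiemData.d2 D.Phi X Y Z = 0) ∧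
    (∀ X Y : V, D.toRiemData.d1 D.eta X Y = 0)

/-- Olszak's characterization of almost cosymplectic manifolds with Kähler leaves:
`(∇_X φ)Y = -g(φ A* X, Y) ξ + η(Y) φ A* X`. -/
def KahlerLeaves : Prop :=
  ∀ X Y : V, D.nabla X (D.phi Y) - D.phi (D.nabla X Y) =
    -(D.g (D.phi (D.Astar X)) Y) • D.xi + D.eta Y • D.phi (D.Astar X)

/-- The normality tensor `N₁(X,Y) = [φ,φ](X,Y) + 2 dη(X,Y) ξ`. -/
def N1 (X Y : V) : V :=
  D.phi (D.phi (D.bracket X Y)) + D.bracket (D.phi X) (D.phi Y)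
    - D.phi (D.bracket (D.phi X) Y) - D.phi (D.bracket X (D.phi Y))
    + (2 * D.toRiemData.d1 D.eta X Y) • D.xi

/-- `N₂(X,Y) = (L_{φX} η)Y - (L_{φY} η)X`. -/
def N2 (X Y : V) : C :=
  (D.act (D.phi X) (D.eta Y) - D.eta (D.bracket (D.phi X) Y))
    - (D.act (D.phi Y) (D.eta X) - D.eta (D.bracket (D.phi Y) X))

/-- `N₃(X) = (L_ξ φ)X = [ξ, φX] - φ[ξ, X]`. -/
def N3 (X : V) : V := D.bracket D.xi (D.phi X) - D.phi (D.bracket D.xi X)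

/-- `N₄(X) = (L_ξ η)X = ξ(η(X)) - η([ξ,X])`. -/
def N4 (X : V) : C := D.act D.xi (D.eta X) - D.eta (D.bracket D.xi X)

/-- `M` is cosymplectic when it is almost cosymplectic and normal (`N₁ = 0`). -/
def Cosymplectic : Prop := D.AlmostCosymplectic ∧ ∀ X Y : V, D.N1 X Y = 0

/-- A `φ`-adapted frame `{eᵢ, φeᵢ, ξ}` built from the family `e`. -/
def phiFrame {m : ℕ} (e : Fin m → V) : (Fin m ⊕ Fin m ⊕ Unit) → V :=
  Sum.elim e (Sum.elim (fun i => D.phi (e i)) (fun _ => D.xi))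

end ACMData

/-- An almost Hermitian structure `(J, g')`: `J² = -I` and `g'(JX, JY) = g'(X,Y)`. -/
structure AHData (C V : Type) [CommRing C] [Algebra ℝ C]
    [AddCommGroup V] [Module C V] extends RiemData C V where
  J : V → V
  J_add : ∀ X Y, J (X + Y) = J X + J Y
  J_smul : ∀ (f : C) X, J (f • X) = f • J X
  J_J : ∀ X, J (J X) = -X
  g_J : ∀ X Y, g (J X) (J Y) = g X Y

namespace AHData

variable {C V : Type} [CommRing C] [Algebra ℝ C] [AddCommGroup V] [Module C V]
variable (D : AHData C V)

/-- The fundamental (Kähler) `2`-form `Ω(X,Y) = g(X, JY)`. -/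
def Omega (X Y : V) : C := D.g X (D.J Y)

/-- Gray's first curvature condition `K₁`: `R(X,Y,Z,W) = R(X,Y,JZ,JW)`. -/
def K1 : Prop :=
  ∀ X Y Z W : V, D.toRiemData.Rm X Y Z W = D.toRiemData.Rm X Y (D.J Z) (D.J W)

/-- `N` is Kähler when `∇'J = 0`. -/
def Kahler : Prop := ∀ X Y : V, D.nabla X (D.J Y) = D.J (D.nabla X Y)

/-- A `J`-adapted frame `{eᵢ, Jeᵢ}` built from the family `e`. -/
def JFrame {n : ℕ} (e : Fin n → V) : (Fin n ⊕ Fin n) → V :=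
  Sum.elim e (fun i => D.J (e i))

end AHData

/-- A contact-complex Riemannian submersion `π : M → N` from an almost contact
metric manifold `M` onto an almost Hermitian manifold `N`, described algebraically:
`pull = π^*` on functions, `rel X X'` means that the vector field `X` on `M` is
`π`-related to `X'` on `N` (`dπ ∘ X = X' ∘ π`), `hor` and `ver` are the orthogonal
projections onto the horizontal distribution `H = (ker dπ)^⊥` and the vertical
distribution `V = ker dπ`.  The submersion is Riemannian (`isometry`) and
`(φ,J)`-holomorphic (`rel_phi`); both distributions are `φ`-invariant and `ξ` is
vertical. -/
structure CCSub (C V C' V' : Type) [CommRing C] [Algebra ℝ C] [AddCommGroup V]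
    [Module C V] [CommRing C'] [Algebra ℝ C'] [AddCommGroup V'] [Module C' V'] where
  M : ACMData C V
  N : AHData C' V'
  pull : C' →+* C
  pull_algebraMap : ∀ r : ℝ, pull ((algebraMap ℝ C') r) = (algebraMap ℝ C) r
  rel : V → V' → Prop
  hor : V → V
  ver : V → V
  hor_add : ∀ X Y, hor (X + Y) = hor X + hor Y
  hor_smul : ∀ (f : C) X, hor (f • X) = f • hor X
  ver_add : ∀ X Y, ver (X + Y) = ver X + ver Y
  ver_smul : ∀ (f : C) X, ver (f • X) = f • ver X
  hor_add_ver : ∀ X, hor X + ver X = X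
  hor_hor : ∀ X, hor (hor X) = hor X
  ver_ver : ∀ X, ver (ver X) = ver X
  hor_ver : ∀ X, hor (ver X) = 0
  ver_hor : ∀ X, ver (hor X) = 0
  g_hor_ver : ∀ X Y, M.g (hor X) (ver Y) = 0
  ver_iff_rel_zero : ∀ X, ver X = X ↔ rel X 0
  rel_add : ∀ {X X' Y Y'}, rel X X' → rel Y Y' → rel (X + Y) (X' + Y')
  rel_smul : ∀ {X X'} (f' : C'), rel X X' → rel (pull f' • X) (f' • X')
  rel_bracket : ∀ {X X' Y Y'}, rel X X' → rel Y Y' → rel (M.bracket X Y) (N.bracket X' Y')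
  rel_act : ∀ {X X'} (f' : C'), rel X X' → M.act X (pull f') = pull (N.act X' f')
  rel_unique : ∀ {X X' Y'}, rel X X' → rel X Y' → X' = Y'
  lift_basic : ∀ X' : V', ∃ X : V, hor X = X ∧ rel X X'
  isometry : ∀ {X X' Y Y'}, rel X X' → rel Y Y' → hor X = X → hor Y = Y →
    M.g X Y = pull (N.g X' Y')
  rel_hor_nabla : ∀ {X X' Y Y'}, rel X X' → rel Y Y' → hor X = X → hor Y = Y →
    rel (hor (M.nabla X Y)) (N.nabla X' Y')
  rel_phi : ∀ {X X'}, rel X X' → rel (M.phi X) (N.J X')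
  hor_phi : ∀ X, hor (M.phi (hor X)) = M.phi (hor X)
  ver_phi : ∀ X, ver (M.phi (ver X)) = M.phi (ver X)
  xi_vertical : ver M.xi = M.xi

namespace CCSub

variable {C V C' V' : Type} [CommRing C] [Algebra ℝ C] [AddCommGroup V] [Module C V]
  [CommRing C'] [Algebra ℝ C'] [AddCommGroup V'] [Module C' V']
variable (S : CCSub C V C' V')

/-- A vector field on `M` is basic when it is horizontal and `π`-related to some
vector field on `N`. -/
def Basic (X : V) : Prop := S.hor X = X ∧ ∃ X' : V', S.rel X X'

/-- O'Neill's tensor `T`: `T_E F = h∇_{vE} vF + v∇_{vE} hF`. -/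
def T (E F : V) : V :=
  S.hor (S.M.nabla (S.ver E) (S.ver F)) + S.ver (S.M.nabla (S.ver E) (S.hor F))

/-- O'Neill's tensor `A`: `A_E F = v∇_{hE} hF + h∇_{hE} vF`. -/
def A (E F : V) : V :=
  S.ver (S.M.nabla (S.hor E) (S.hor F)) + S.hor (S.M.nabla (S.hor E) (S.ver F))

/-- The tensor `B` of a contact-complex Riemannian submersion:
`B(E,F) = v∇_{hE} φhF - v∇_{φhE} hF + h∇_{hE} φvF - h∇_{φhE} vF`. -/
def B (E F : V) : V :=
  S.ver (S.M.nabla (S.hor E) (S.M.phi (S.hor F)))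
    - S.ver (S.M.nabla (S.M.phi (S.hor E)) (S.hor F))
    + S.hor (S.M.nabla (S.hor E) (S.M.phi (S.ver F)))
    - S.hor (S.M.nabla (S.M.phi (S.hor E)) (S.ver F))

/-- The curvature of a fibre (a `φ`-invariant submanifold), computed via the Gauss
induced connection `∇̂_U W = v∇_U W` for vertical fields. -/
def fibR (U W F : V) : V :=
  S.ver (S.M.nabla U (S.ver (S.M.nabla W F)))
    - S.ver (S.M.nabla W (S.ver (S.M.nabla U F)))
    - S.ver (S.M.nabla (S.M.bracket U W) F)

/-- Covariant derivative of a `2`-form along the fibres, using the induced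
connection `∇̂_U W = v∇_U W`. -/
def fibCov2 (ω : V → V → C) (U W F : V) : C :=
  S.M.act U (ω W F) - ω (S.ver (S.M.nabla U W)) F - ω W (S.ver (S.M.nabla U F))

/-- Codifferential on a fibre (with the induced metric) of a `2`-form, computed in
a vertical orthonormal frame `e`. -/
def fibCodiff2 {ι : Type} [Fintype ι] (e : ι → V) (ω : V → V → C) (F : V) : C :=
  -∑ i, S.fibCov2 ω (e i) (e i) F

/-- The vertical `φ`-adapted frame `{V_j, φV_j, ξ}`. -/
def vertFrame {p : ℕ} (Vf : Fin p → V) : (Fin p ⊕ Fin p ⊕ Unit) → V :=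
  Sum.elim Vf (Sum.elim (fun j => S.M.phi (Vf j)) (fun _ => S.M.xi))

/-- The `φ`-adapted frame `{Xᵢ, φXᵢ, V_j, φV_j, ξ}` of the total space, with
`Xᵢ` basic and `V_j` vertical. -/
def adaptedFrame {n p : ℕ} (Xb : Fin n → V) (Vf : Fin p → V) :
    ((Fin n ⊕ Fin n) ⊕ (Fin p ⊕ Fin p ⊕ Unit)) → V :=
  Sum.elim (Sum.elim Xb (fun i => S.M.phi (Xb i))) (S.vertFrame Vf)

/-- The mean curvature vector field of the fibres, i.e. the horizontal trace
`H = ∑ h∇_{e_j} e_j` over the vertical frame `{V_j, φV_j, ξ}`. -/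
def meanCurv {p : ℕ} (Vf : Fin p → V) : V :=
  (∑ j, S.hor (S.M.nabla (Vf j) (Vf j)))
    + (∑ j, S.hor (S.M.nabla (S.M.phi (Vf j)) (S.M.phi (Vf j))))
    + S.hor (S.M.nabla S.M.xi S.M.xi)

/-- The trace `Tr B^h` of the restriction of `B` to the horizontal distribution,
computed in the horizontal frame `{Xᵢ, φXᵢ}`. -/
def trBh {n : ℕ} (Xb : Fin n → V) : V :=
  (∑ i, S.B (Xb i) (Xb i)) + (∑ i, S.B (S.M.phi (Xb i)) (S.M.phi (Xb i)))

end CCSub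

variable {C V C' V' : Type} [CommRing C] [Algebra ℝ C] [AddCommGroup V] [Module C V]
  [CommRing C'] [Algebra ℝ C'] [AddCommGroup V'] [Module C' V']

namespace RiemData

theorem nabla_zero_right (D : RiemData C V) (X : V) : D.nabla X 0 = 0 := by
  simpa using D.nabla_add_right X 0 0

theorem nabla_neg_left (D : RiemData C V) (X Y : V) : D.nabla (-X) Y = -D.nabla X Y := by
  simpa using D.nabla_smul_left (-1) X Y

theorem nabla_neg_right (D : RiemData C V) (X Y : V) : D.nabla X (-Y) = -D.nabla X Y := by
  refine eq_neg_of_add_eq_zero_left ?_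
  rw [← D.nabla_add_right, neg_add_cancel, D.nabla_zero_right]

end RiemData

namespace CCSub

theorem hor_zero (S : CCSub C V C' V') : S.hor 0 = 0 := by
  simpa using S.hor_add 0 0

theorem ver_neg (S : CCSub C V C' V') (X : V) : S.ver (-X) = -S.ver X := by
  simpa using S.ver_smul (-1) X

theorem ver_eq_zero_of_hor_eq (S : CCSub C V C' V') {X : V} (hX : S.hor X = X) :
    S.ver X = 0 := by
  rw [← hX, S.ver_hor]

theorem hor_phi_of_hor_eq (S : CCSub C V C' V') {X : V} (hX : S.hor X = X) :
    S.hor (S.M.phi X) = S.M.phi X := by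
  simpa only [hX] using S.hor_phi X

theorem eta_eq_zero_of_hor_eq (S : CCSub C V C' V') {X : V} (hX : S.hor X = X) :
    S.M.eta X = 0 := by
  rw [S.M.eta_eq, ← hX, ← S.xi_vertical, S.g_hor_ver]

theorem phi_phi_of_hor_eq (S : CCSub C V C' V') {X : V} (hX : S.hor X = X) :
    S.M.phi (S.M.phi X) = -X := by
  rw [S.M.phi_phi, S.eta_eq_zero_of_hor_eq hX, zero_smul, add_zero]

/-- On horizontal vector fields, `B(X, Y) = v∇_X φY - v∇_{φX} Y`. -/
theorem B_of_hor_eq (S : CCSub C V C' V') {X Y : V} (hX : S.hor X = X) (hY : S.hor Y = Y) :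
    S.B X Y = S.ver (S.M.nabla X (S.M.phi Y)) - S.ver (S.M.nabla (S.M.phi X) Y) := by
  have hphi : S.M.phi 0 = 0 := by simpa using S.M.phi_add 0 0
  simp [B, hX, hY, S.ver_eq_zero_of_hor_eq hY, hphi, RiemData.nabla_zero_right, S.hor_zero]

end CCSub

/-- The restriction of the tensor `B` of a contact-complex
Riemannian submersion to the horizontal distribution is `φ`-invariant:
`B(φX, φY) = B(X, Y)` for horizontal `X, Y`. -/
theorem B_phi_invariant (S : CCSub C V C' V') :
    ∀ X Y : V, S.hor X = X → S.hor Y = Y →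
      S.B (S.M.phi X) (S.M.phi Y) = S.B X Y := by
  intro X Y hX hY
  rw [S.B_of_hor_eq (S.hor_phi_of_hor_eq hX) (S.hor_phi_of_hor_eq hY), S.B_of_hor_eq hX hY,
    S.phi_phi_of_hor_eq hX, S.phi_phi_of_hor_eq hY, RiemData.nabla_neg_left,
    RiemData.nabla_neg_right, S.ver_neg, S.ver_neg]
  abel
end

section
/- Let M(φ, ξ, η, g) be an almost cosymplectic manifold with Kähler leaves. Then its fundamental 2-form Φ is harmonic: δΦ = 0 and dΦ = 0, hence ΔΦ = (dδ + δd)Φ = 0. -/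
variable {C V : Type} [CommRing C] [Algebra ℝ C] [AddCommGroup V] [Module C V]

namespace RiemData

variable (D : RiemData C V)

theorem g_add_right (X Y Z : V) : D.g X (Y + Z) = D.g X Y + D.g X Z := by
  rw [D.g_symm, D.g_add_left, D.g_symm Y, D.g_symm Z]

theorem g_smul_right (f : C) (X Y : V) : D.g X (f • Y) = f * D.g X Y := by
  rw [D.g_symm, D.g_smul_left, D.g_symm]

theorem g_neg_left (X Y : V) : D.g (-X) Y = -D.g X Y := by
  simpa using D.g_smul_left (-1) X Y

theorem g_neg_right (X Y : V) : D.g X (-Y) = -D.g X Y := by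
  rw [D.g_symm, D.g_neg_left, D.g_symm]

theorem g_sub_right (X Y Z : V) : D.g X (Y - Z) = D.g X Y - D.g X Z := by
  rw [sub_eq_add_neg, D.g_add_right, D.g_neg_right, sub_eq_add_neg]

theorem act_zero (X : V) : D.act X 0 = 0 := by
  simpa using D.act_const X 0

theorem act_one (X : V) : D.act X 1 = 0 := by
  simpa using D.act_const X 1

/-- A vector field of constant unit length is orthogonal to its covariant derivatives. -/
theorem g_nabla_self_of_unit {Z : V} (hZ : D.g Z Z = 1) (X : V) :
    D.g (D.nabla X Z) Z = 0 := by
  have h := D.nabla_metric X Z Z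
  rw [hZ, D.act_one, D.g_symm Z, ← two_smul ℝ] at h
  exact (smul_eq_zero_iff_right (two_ne_zero' ℝ)).mp h.symm

theorem d1_zero (X Y : V) : D.d1 (fun _ => 0) X Y = 0 := by
  simp [d1, D.act_zero]

theorem codiff3_zero {ι : Type} [Fintype ι] (e : ι → V) (X Y : V) :
    D.codiff3 e (fun _ _ _ => 0) X Y = 0 := by
  simp [codiff3, cov3, D.act_zero]

end RiemData

namespace ACMData

variable (D : ACMData C V)

theorem g_xi_xi : D.g D.xi D.xi = 1 := by
  rw [← D.eta_eq, D.eta_xi]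

theorem eta_Astar (X : V) : D.eta (D.Astar X) = 0 := by
  rw [D.eta_eq, Astar, D.g_neg_left, D.g_nabla_self_of_unit D.g_xi_xi, neg_zero]

/-- Over a ring with nilpotents `φξ` need not vanish, but it is always a multiple of `ξ`. -/
theorem eta_phi (X : V) : D.eta (D.phi X) = D.eta (D.phi D.xi) * D.eta X := by
  have hphi (Y : V) : D.eta Y • D.phi D.xi = D.eta (D.phi Y) • D.xi := by
    have h := D.phi_phi (D.phi Y)
    rw [D.phi_phi Y, D.phi_add, D.phi_smul, ← neg_one_smul C Y, D.phi_smul, neg_one_smul] at h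
    exact add_left_cancel h
  have h := congrArg (fun Z => D.g Z D.xi) (hphi X)
  simp only [D.g_smul_left, ← D.eta_eq, D.eta_xi, mul_one] at h
  rw [← h, mul_comm]

theorem g_phi_eq_neg_of_eta_eq_zero {X : V} (hX : D.eta X = 0) (Y : V) :
    D.g (D.phi X) Y = -D.g X (D.phi Y) := by
  have h := D.g_phi X (D.phi Y)
  rw [D.phi_phi, D.g_add_right, D.g_neg_right, D.g_smul_right, ← D.eta_eq, D.eta_phi, hX] at h
  linear_combination -h

theorem cov2_Phi (X Y Z : V) :
    D.cov2 D.Phi X Y Z = D.g Y (D.nabla X (D.phi Z) - D.phi (D.nabla X Z)) := by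
  simp only [RiemData.cov2, Phi, D.nabla_metric, D.g_sub_right]
  ring

theorem KahlerLeaves.cov2_Phi {D : ACMData C V} (h : D.KahlerLeaves) (X Y Z : V) :
    D.cov2 D.Phi X Y Z =
      D.eta Y * D.g (D.Astar X) (D.phi Z) - D.eta Z * D.g (D.Astar X) (D.phi Y) := by
  rw [D.cov2_Phi, h, D.g_add_right, D.g_smul_right, D.g_smul_right, ← D.eta_eq,
    D.g_symm Y, D.g_phi_eq_neg_of_eta_eq_zero (D.eta_Astar X),
    D.g_phi_eq_neg_of_eta_eq_zero (D.eta_Astar X)]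
  ring

theorem AlmostCosymplectic.g_Astar_comm {D : ACMData C V} (h : D.AlmostCosymplectic) (X Y : V) :
    D.g (D.Astar X) Y = D.g (D.Astar Y) X := by
  have hd := h.2 X Y
  simp only [RiemData.d1, D.eta_eq, D.nabla_metric, ← D.nabla_torsion_free, sub_eq_add_neg,
    D.g_add_left, D.g_neg_left] at hd
  rw [D.g_symm Y, D.g_symm X] at hd
  rw [Astar, Astar, D.g_neg_left, D.g_neg_left]
  linear_combination -hd

theorem AlmostCosymplectic.g_Astar_xi {D : ACMData C V} (h : D.AlmostCosymplectic) (Y : V) :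
    D.g (D.Astar D.xi) Y = 0 := by
  rw [h.g_Astar_comm, ← D.eta_eq, D.eta_Astar]

/-- The fundamental form is coclosed, for any orthonormal family `{eᵢ, φeᵢ, ξ}`. -/
theorem codiff2_Phi_eq_zero {D : ACMData C V}
    (hac : D.AlmostCosymplectic) (hkl : D.KahlerLeaves) {m : ℕ} (e : Fin m → V)
    (hON : D.Orthonormal (D.phiFrame e)) (X : V) :
    D.codiff2 (D.phiFrame e) D.Phi X = 0 := by
  have he (i : Fin m) : D.eta (e i) = 0 := by
    rw [D.eta_eq]
    simpa [phiFrame] using hON (Sum.inl i) (Sum.inr (Sum.inr ()))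
  have hpair (i : Fin m) :
      D.cov2 D.Phi (e i) (e i) X + D.cov2 D.Phi (D.phi (e i)) (D.phi (e i)) X = 0 := by
    rw [hkl.cov2_Phi, hkl.cov2_Phi, D.eta_phi, he, D.phi_phi, he, zero_smul, add_zero,
      D.g_neg_right, hac.g_Astar_comm (D.phi (e i)) (e i)]
    ring
  have hxi : D.cov2 D.Phi D.xi D.xi X = 0 := by
    rw [hkl.cov2_Phi, hac.g_Astar_xi, hac.g_Astar_xi]
    ring
  simp [RiemData.codiff2, phiFrame, hxi, ← Finset.sum_add_distrib, -neg_add_rev,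
    hpair]

end ACMData

/-- On an almost cosymplectic manifold with Kähler leaves the
fundamental `2`-form `Φ` is harmonic: `δΦ = 0` (computed in a `φ`-orthonormal
frame `{eᵢ, φeᵢ, ξ}`), `dΦ = 0`, and hence `ΔΦ = (dδ + δd)Φ = 0`. -/
theorem fundamental_form_harmonic (D : ACMData C V)
    (hac : D.AlmostCosymplectic) (hkl : D.KahlerLeaves)
    {m : ℕ} (e : Fin m → V)
    (hON : D.toRiemData.Orthonormal (D.phiFrame e)) :
    (∀ X : V, D.toRiemData.codiff2 (D.phiFrame e) D.Phi X = 0) ∧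
    (∀ X Y Z : V, D.toRiemData.d2 D.Phi X Y Z = 0) ∧
    (∀ X Y : V,
      D.toRiemData.d1 (D.toRiemData.codiff2 (D.phiFrame e) D.Phi) X Y
        + D.toRiemData.codiff3 (D.phiFrame e) (D.toRiemData.d2 D.Phi) X Y = 0) := by
  have hδ := ACMData.codiff2_Phi_eq_zero hac hkl e hON
  have hδ0 : D.toRiemData.codiff2 (D.phiFrame e) D.Phi = fun _ => 0 := funext hδ
  have hd0 : D.toRiemData.d2 D.Phi = fun _ _ _ => 0 := by
    ext X Y Z
    exact hac.1 X Y Z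
  refine ⟨hδ, hac.1, fun X Y => ?_⟩
  rw [hδ0, hd0, RiemData.d1_zero, RiemData.codiff3_zero, add_zero]
end
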